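/- Let (J^ℱ,(f_n)) be a unimodal nonautonomous discrete dynamical system satisfying the limit property with uniform limit map f. Then for every k≥1 and every ε>0 there exists N≥1 such that for all n≥N the finite sets 𝒞_n^k(ℱ) and 𝒞^k(f) have the same cardinality, and the unique order-preserving bijection φ_n:𝒞^k(f)→𝒞_n^k(ℱ) satisfies |φ_n(x)−x|<ε for all x∈𝒞^k(f). -/

import Mathlib

open Set

noncomputable section

/-- The nonautonomous iterate `f_n^ℓ = f_{n+ℓ-1} ∘ ⋯ ∘ f_n` (and `f_n^0 = id`). -/
def iterFrom (f : ℕ → ℝ → ℝ) : ℕ → ℕ → ℝ → ℝ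
  | _, 0, x => x
  | n, ℓ + 1, x => f (n + ℓ) (iterFrom f n ℓ x)

/-- `(Icc a b, (f n))` is a unimodal nonautonomous discrete dynamical system with
turning points `c n`. -/
def IsUNDS (a b : ℝ) (f : ℕ → ℝ → ℝ) (c : ℕ → ℝ) : Prop :=
  a < b ∧ ∀ n : ℕ,
    ContinuousOn (f n) (Icc a b) ∧
    MapsTo (f n) (Icc a b) (Icc a b) ∧
    f n a = a ∧ f n b = a ∧
    c n ∈ Ioo a b ∧
    StrictMonoOn (f n) (Icc a (c n)) ∧
    StrictAntiOn (f n) (Icc (c n) b)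

/-- The two systems have the same kneading sequence. -/
def SameKneading (f : ℕ → ℝ → ℝ) (cF : ℕ → ℝ) (g : ℕ → ℝ → ℝ) (cG : ℕ → ℝ) : Prop :=
  ∀ n ℓ : ℕ,
    (iterFrom f n ℓ (cF n) < cF (n + ℓ) ↔ iterFrom g n ℓ (cG n) < cG (n + ℓ)) ∧
    (iterFrom f n ℓ (cF n) = cF (n + ℓ) ↔ iterFrom g n ℓ (cG n) = cG (n + ℓ))

/-- `𝒞_n(ℱ)`: points of `Icc a b` eventually mapped onto a turning point. -/
def critSet (a b : ℝ) (f : ℕ → ℝ → ℝ) (c : ℕ → ℝ) (n : ℕ) : Set ℝ :=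
  {x ∈ Icc a b | ∃ ℓ : ℕ, iterFrom f n ℓ x = c (n + ℓ)}

/-- A (single) unimodal map on `Icc a b` with turning point `cg`. -/
def IsUnimodal (a b : ℝ) (g : ℝ → ℝ) (cg : ℝ) : Prop :=
  ContinuousOn g (Icc a b) ∧ MapsTo g (Icc a b) (Icc a b) ∧
  g a = a ∧ g b = a ∧ cg ∈ Ioo a b ∧
  StrictMonoOn g (Icc a cg) ∧ StrictAntiOn g (Icc cg b)

/-- `𝒞(g)` for an autonomous unimodal map `g`. -/
def critSetMap (a b : ℝ) (g : ℝ → ℝ) (cg : ℝ) : Set ℝ :=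
  {x ∈ Icc a b | ∃ ℓ : ℕ, g^[ℓ] x = cg}

/-- The limit property for a UNDS. -/
def LimitProperty (a b : ℝ) (f : ℕ → ℝ → ℝ) (c : ℕ → ℝ) : Prop :=
  ∃ (g : ℝ → ℝ) (cg : ℝ),
    IsUnimodal a b g cg ∧
    (∀ m : ℕ, 1 ≤ m → g^[m] cg ≠ cg) ∧
    TendstoUniformlyOn (fun n => f n) g Filter.atTop (Icc a b) ∧
    (∀ n : ℕ, Icc a b ⊆ closure (critSet a b f c n)) ∧
    Icc a b ⊆ closure (critSetMap a b g cg)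

/-- `𝒞_n^k(ℱ)`: points mapped onto a turning point within the first `k` levels. -/
def critSetK (a b : ℝ) (f : ℕ → ℝ → ℝ) (c : ℕ → ℝ) (n k : ℕ) : Set ℝ :=
  {x ∈ Icc a b | ∃ ℓ < k, iterFrom f n ℓ x = c (n + ℓ)}

/-- `𝒞^k(f)` for an autonomous unimodal map `f` with turning point `cf`. -/
def critSetKMap (a b : ℝ) (f : ℝ → ℝ) (cf : ℝ) (k : ℕ) : Set ℝ :=
  {x ∈ Icc a b | ∃ ℓ < k, f^[ℓ] x = cf}

open Filter Topology

lemma iterFrom_succ' (f : ℕ → ℝ → ℝ) (n ℓ : ℕ) (x : ℝ) :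
    iterFrom f n (ℓ + 1) x = iterFrom f (n + 1) ℓ (f n x) := by
  induction ℓ with
  | zero => rfl
  | succ ℓ ih =>
    rw [iterFrom, ih, iterFrom, show n + (ℓ + 1) = n + 1 + ℓ by omega]

lemma mem_critSetK_succ {a b : ℝ} {f : ℕ → ℝ → ℝ} {c : ℕ → ℝ} {n k : ℕ} {x : ℝ}
    (hm : MapsTo (f n) (Icc a b) (Icc a b)) :
    x ∈ critSetK a b f c n (k + 1) ↔
      x ∈ Icc a b ∧ (x = c n ∨ f n x ∈ critSetK a b f c (n + 1) k) := by
  refine and_congr_right fun hx => ⟨?_, ?_⟩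
  · rintro ⟨_ | ℓ, hℓ, h⟩
    · exact Or.inl h
    · rw [iterFrom_succ', show n + (ℓ + 1) = n + 1 + ℓ by omega] at h
      exact Or.inr ⟨hm hx, ℓ, by omega, h⟩
  · rintro (h | ⟨-, ℓ, hℓ, h⟩)
    · exact ⟨0, by omega, h⟩
    · refine ⟨ℓ + 1, by omega, ?_⟩
      rw [iterFrom_succ', h, show n + (ℓ + 1) = n + 1 + ℓ by omega]

lemma mem_critSetKMap_succ {a b : ℝ} {g : ℝ → ℝ} {cg : ℝ} {k : ℕ} {x : ℝ}
    (hm : MapsTo g (Icc a b) (Icc a b)) :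
    x ∈ critSetKMap a b g cg (k + 1) ↔
      x ∈ Icc a b ∧ (x = cg ∨ g x ∈ critSetKMap a b g cg k) := by
  refine and_congr_right fun hx => ⟨?_, ?_⟩
  · rintro ⟨_ | ℓ, hℓ, h⟩
    · exact Or.inl h
    · exact Or.inr ⟨hm hx, ℓ, by omega, h⟩
  · rintro (h | ⟨-, ℓ, hℓ, h⟩)
    · exact ⟨0, by omega, h⟩
    · exact ⟨ℓ + 1, by omega, h⟩

lemma critSetKMap_finite {a b : ℝ} {g : ℝ → ℝ} {cg : ℝ} (hg : IsUnimodal a b g cg) (k : ℕ) :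
    (critSetKMap a b g cg k).Finite := by
  obtain ⟨-, hm, -, -, -, hmono, hanti⟩ := hg
  induction k with
  | zero =>
    convert Set.finite_empty (α := ℝ)
    ext x
    simp [critSetKMap]
  | succ k ih =>
    have hleft : (Icc a cg ∩ g ⁻¹' critSetKMap a b g cg k).Finite :=
      Set.Finite.of_injOn (f := g) (fun x hx => hx.2) (hmono.injOn.mono inter_subset_left) ih
    have hright : (Icc cg b ∩ g ⁻¹' critSetKMap a b g cg k).Finite :=
      Set.Finite.of_injOn (f := g) (fun x hx => hx.2) (hanti.injOn.mono inter_subset_left) ih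
    refine ((Set.finite_singleton cg).union (hleft.union hright)).subset fun x hx => ?_
    obtain ⟨hx, h | h⟩ := (mem_critSetKMap_succ hm).1 hx
    · exact Or.inl h
    · rcases le_total x cg with hc | hc
      · exact Or.inr (Or.inl ⟨⟨hx.1, hc⟩, h⟩)
      · exact Or.inr (Or.inr ⟨⟨hc, hx.2⟩, h⟩)

/-- Turning points of a pointwise convergent sequence of unimodal maps converge. -/
lemma tendsto_turningPoint {a b : ℝ} {f : ℕ → ℝ → ℝ} {c : ℕ → ℝ} {g : ℝ → ℝ} {cg : ℝ}
    (hF : IsUNDS a b f c) (hg : IsUnimodal a b g cg)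
    (hlim : ∀ x ∈ Icc a b, Tendsto (fun n => f n x) atTop (𝓝 (g x))) :
    Tendsto c atTop (𝓝 cg) := by
  obtain ⟨-, hF⟩ := hF
  obtain ⟨-, -, -, -, hcg, hmono, hanti⟩ := hg
  have hcg' : cg ∈ Icc a b := Ioo_subset_Icc_self hcg
  rw [tendsto_order]
  constructor
  · intro u hu
    rcases lt_or_ge u a with hua | hua
    · exact Eventually.of_forall fun n => hua.trans (hF n).2.2.2.2.1.1
    · have hub : u ∈ Icc a b := ⟨hua, hu.le.trans hcg'.2⟩
      filter_upwards [(hlim u hub).eventually_lt (hlim cg hcg')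
        (hmono ⟨hua, hu.le⟩ ⟨hcg'.1, le_rfl⟩ hu)] with n hn
      by_contra! hc
      exact hn.not_gt ((hF n).2.2.2.2.2.2 ⟨hc, hub.2⟩ ⟨hc.trans hu.le, hcg'.2⟩ hu)
  · intro u hu
    rcases lt_or_ge b u with hub | hub
    · exact Eventually.of_forall fun n => (hF n).2.2.2.2.1.2.trans hub
    · have hua : u ∈ Icc a b := ⟨hcg'.1.trans hu.le, hub⟩
      filter_upwards [(hlim u hua).eventually_lt (hlim cg hcg')
        (hanti ⟨le_rfl, hcg'.2⟩ ⟨hu.le, hub⟩ hu)] with n hn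
      by_contra! hc
      exact hn.not_gt ((hF n).2.2.2.2.2.1 ⟨hcg'.1, hu.le.trans hc⟩ ⟨hua.1, hc⟩ hu)

/-- Preimages under the increasing branches `f n` on `Icc a (c n)` converge to the preimage under
the increasing limit branch. -/
lemma exists_tendsto_preimage_of_strictMonoOn {a : ℝ} {f : ℕ → ℝ → ℝ} {c : ℕ → ℝ}
    {g : ℝ → ℝ} {cg x : ℝ} {d : ℕ → ℝ}
    (hcont : ∀ n, ContinuousOn (f n) (Icc a (c n)))
    (hmono : ∀ n, StrictMonoOn (f n) (Icc a (c n)))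
    (hgmono : StrictMonoOn g (Icc a cg))
    (hlim : ∀ x ∈ Icc a cg, Tendsto (fun n => f n x) atTop (𝓝 (g x)))
    (hc : Tendsto c atTop (𝓝 cg)) (hx : x ∈ Ico a cg)
    (hd : Tendsto d atTop (𝓝 (g x))) (hda : ∀ᶠ n in atTop, f n a ≤ d n) :
    ∃ y : ℕ → ℝ, Tendsto y atTop (𝓝 x) ∧
      ∀ᶠ n in atTop, y n ∈ Icc a (c n) ∧ f n (y n) = d n := by
  have habove : ∀ v ∈ Ioo x cg, ∀ᶠ n in atTop, v ∈ Icc a (c n) ∧ d n < f n v := by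
    intro v hv
    have hva : a ≤ v := hx.1.trans hv.1.le
    filter_upwards [hc.eventually_const_lt hv.2, hd.eventually_lt (hlim v ⟨hva, hv.2.le⟩)
      (hgmono ⟨hx.1, hx.2.le⟩ ⟨hva, hv.2.le⟩ hv.1)] with n h1 h2
    exact ⟨⟨hva, h1.le⟩, h2⟩
  have hex : ∀ᶠ n in atTop, ∃ y ∈ Icc a (c n), f n y = d n := by
    obtain ⟨v, hv⟩ := exists_between hx.2
    filter_upwards [habove v hv, hda] with n h1 h2
    obtain ⟨y, hy, hyd⟩ := intermediate_value_Icc h1.1.1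
      ((hcont n).mono (Icc_subset_Icc_right h1.1.2)) ⟨h2, h1.2.le⟩
    exact ⟨y, Icc_subset_Icc_right h1.1.2 hy, hyd⟩
  obtain ⟨y, hy⟩ := hex.choice
  refine ⟨y, tendsto_order.2 ⟨fun u hu => ?_, fun v hv => ?_⟩, hy⟩
  · rcases lt_or_ge u a with hua | hua
    · filter_upwards [hy] with n hn
      exact hua.trans_le hn.1.1
    · have huc : u < cg := hu.trans hx.2
      filter_upwards [hy, hc.eventually_const_lt huc, (hlim u ⟨hua, huc.le⟩).eventually_lt hd
        (hgmono ⟨hua, huc.le⟩ ⟨hx.1, hx.2.le⟩ hu)] with n h1 h2 h3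
      rw [← h1.2] at h3
      exact ((hmono n).lt_iff_lt ⟨hua, h2.le⟩ h1.1).1 h3
  · obtain ⟨w, hxw, hw⟩ := exists_between (lt_min hv hx.2)
    filter_upwards [hy, habove w ⟨hxw, hw.trans_le (min_le_right _ _)⟩] with n h1 h2
    have h3 := h2.2
    rw [← h1.2] at h3
    exact (((hmono n).lt_iff_lt h1.1 h2.1).1 h3).trans (hw.trans_le (min_le_left _ _))

/-- Noncritical preimages under the maps of a UNDS converge to preimages under the limit map. -/
lemma exists_tendsto_preimage {a b : ℝ} {f : ℕ → ℝ → ℝ} {c : ℕ → ℝ} {g : ℝ → ℝ} {cg x : ℝ}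
    {d : ℕ → ℝ} (hF : IsUNDS a b f c) (hg : IsUnimodal a b g cg)
    (hlim : ∀ x ∈ Icc a b, Tendsto (fun n => f n x) atTop (𝓝 (g x)))
    (hx : x ∈ Icc a b) (hxc : x ≠ cg)
    (hd : Tendsto d atTop (𝓝 (g x))) (hda : ∀ᶠ n in atTop, a ≤ d n) :
    ∃ y : ℕ → ℝ, Tendsto y atTop (𝓝 x) ∧
      ∀ᶠ n in atTop, y n ∈ Icc a b ∧ f n (y n) = d n := by
  have hc := tendsto_turningPoint hF hg hlim
  obtain ⟨-, hF⟩ := hF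
  obtain ⟨-, -, -, -, hcg, hmono, hanti⟩ := hg
  rcases hxc.lt_or_gt with hlt | hgt
  · obtain ⟨y, hy, h⟩ := exists_tendsto_preimage_of_strictMonoOn
      (fun n => (hF n).1.mono (Icc_subset_Icc_right (hF n).2.2.2.2.1.2.le))
      (fun n => (hF n).2.2.2.2.2.1) hmono
      (fun x hx => hlim x ⟨hx.1, hx.2.trans hcg.2.le⟩) hc ⟨hx.1, hlt⟩ hd
      (hda.mono fun n hn => (hF n).2.2.1.trans_le hn)
    refine ⟨y, hy, h.mono fun n hn => ⟨⟨hn.1.1, hn.1.2.trans (hF n).2.2.2.2.1.2.le⟩, hn.2⟩⟩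
  · have hneg : ∀ {p : ℝ}, MapsTo (fun t : ℝ => -t) (Icc (-b) (-p)) (Icc p b) := fun {p} t ht =>
      ⟨by linarith [ht.2], by linarith [ht.1]⟩
    obtain ⟨y, hy, h⟩ := exists_tendsto_preimage_of_strictMonoOn (a := -b) (x := -x)
      (f := fun n t => f n (-t)) (c := fun n => -c n) (g := fun t => g (-t)) (cg := -cg) (d := d)
      (fun n => ((hF n).1.mono (Icc_subset_Icc_left (hF n).2.2.2.2.1.1.le)).comp
        continuous_neg.continuousOn hneg)
      (fun n s hs t ht hst => (hF n).2.2.2.2.2.2 (hneg ht) (hneg hs) (neg_lt_neg hst))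
      (fun s hs t ht hst => hanti (hneg ht) (hneg hs) (neg_lt_neg hst))
      (fun t ht => hlim _ ⟨hcg.1.le.trans (hneg ht).1, (hneg ht).2⟩) hc.neg
      ⟨neg_le_neg hx.2, neg_lt_neg hgt⟩ (by simpa using hd)
      (hda.mono fun n hn => by simpa [(hF n).2.2.2.1] using hn)
    refine ⟨fun n => -y n, by simpa using hy.neg, h.mono fun n hn => ⟨⟨?_, ?_⟩, hn.2⟩⟩
    · exact (hF n).2.2.2.2.1.1.le.trans (hneg hn.1).1
    · exact (hneg hn.1).2

lemma IsUnimodal.exists_eq_of_lt {a b : ℝ} {g : ℝ → ℝ} {cg d : ℝ} (hg : IsUnimodal a b g cg)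
    (had : a ≤ d) (hd : d < g cg) :
    (∃ x ∈ Icc a b, x < cg ∧ g x = d) ∧ ∃ x ∈ Icc a b, cg < x ∧ g x = d := by
  obtain ⟨hcont, -, ha, hb, hcg, -, -⟩ := hg
  constructor
  · obtain ⟨x, hx, rfl⟩ := intermediate_value_Icc hcg.1.le
      (hcont.mono (Icc_subset_Icc_right hcg.2.le)) ⟨ha.trans_le had, hd.le⟩
    exact ⟨x, ⟨hx.1, hx.2.trans hcg.2.le⟩, hx.2.lt_of_ne (by rintro rfl; exact hd.ne rfl), rfl⟩
  · obtain ⟨x, hx, rfl⟩ := intermediate_value_Icc' hcg.2.le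
      (hcont.mono (Icc_subset_Icc_left hcg.1.le)) ⟨hb.trans_le had, hd.le⟩
    exact ⟨x, ⟨hcg.1.le.trans hx.1, hx.2⟩, hx.1.lt_of_ne (by rintro rfl; exact hd.ne rfl), rfl⟩

lemma IsUNDS.le_apply_turningPoint {a b : ℝ} {f : ℕ → ℝ → ℝ} {c : ℕ → ℝ} (hF : IsUNDS a b f c)
    (n : ℕ) {x : ℝ} (hx : x ∈ Icc a b) : f n x ≤ f n (c n) := by
  obtain ⟨-, -, -, -, hc, hmono, hanti⟩ := hF.2 n
  rcases le_total x (c n) with h | h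
  · exact hmono.monotoneOn ⟨hx.1, h⟩ ⟨hc.1.le, le_rfl⟩ h
  · exact hanti.antitoneOn ⟨le_rfl, hc.2.le⟩ ⟨h, hx.2⟩ h

/-- For large `n` there are bijections `critSetKMap a b g cg k → critSetK a b f c n k` converging
pointwise to the identity. -/
lemma exists_bijOn_critSetK_tendsto {a b : ℝ} {f : ℕ → ℝ → ℝ} {c : ℕ → ℝ} {g : ℝ → ℝ} {cg : ℝ}
    (hF : IsUNDS a b f c) (hg : IsUnimodal a b g cg) (hper : ∀ m : ℕ, 1 ≤ m → g^[m] cg ≠ cg)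
    (hconv : TendstoUniformlyOn f g atTop (Icc a b)) (k : ℕ) :
    ∃ φ : ℕ → ℝ → ℝ,
      (∀ᶠ n in atTop, BijOn (φ n) (critSetKMap a b g cg k) (critSetK a b f c n k)) ∧
      ∀ x ∈ critSetKMap a b g cg k, Tendsto (fun n => φ n x) atTop (𝓝 x) := by
  have hlim : ∀ x ∈ Icc a b, Tendsto (fun n => f n x) atTop (𝓝 (g x)) :=
    fun x hx => hconv.tendsto_at hx
  have hc := tendsto_turningPoint hF hg hlim
  have hcg : cg ∈ Icc a b := Ioo_subset_Icc_self hg.2.2.2.2.1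
  have hcn : ∀ n, c n ∈ Icc a b := fun n => Ioo_subset_Icc_self (hF.2 n).2.2.2.2.1
  have hfc : Tendsto (fun n => f n (c n)) atTop (𝓝 (g cg)) :=
    hconv.tendsto_comp (hg.1 cg hcg)
      (tendsto_nhdsWithin_iff.2 ⟨hc, Eventually.of_forall hcn⟩)
  induction k with
  | zero =>
    refine ⟨fun _ x => x, Eventually.of_forall fun n => ?_, fun x hx => tendsto_const_nhds⟩
    simp [critSetKMap, critSetK]
  | succ k ih =>
    obtain ⟨φ, hφ, hφlim⟩ := ih
    have hφ' := (tendsto_add_atTop_nat 1).eventually hφ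
    have hφlim' : ∀ x ∈ critSetKMap a b g cg k, Tendsto (fun n => φ (n + 1) x) atTop (𝓝 x) :=
      fun x hx => (hφlim x hx).comp (tendsto_add_atTop_nat 1)
    have hgc : g cg ∉ critSetKMap a b g cg k := by
      rintro ⟨-, ℓ, -, h⟩
      exact hper (ℓ + 1) (by omega) h
    have hy : ∀ x : critSetKMap a b g cg (k + 1), ∃ y : ℕ → ℝ, Tendsto y atTop (𝓝 x.1) ∧
        ∀ᶠ n in atTop, y n ∈ Icc a b ∧ ((x.1 = cg ∧ y n = c n) ∨
          (g x ∈ critSetKMap a b g cg k ∧ f n (y n) = φ (n + 1) (g x))) := by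
      rintro ⟨x, hx⟩
      obtain ⟨hx, h⟩ := (mem_critSetKMap_succ hg.2.1).1 hx
      by_cases hxc : x = cg
      · exact ⟨c, by simpa [hxc] using hc, Eventually.of_forall fun n => ⟨hcn n, Or.inl ⟨hxc, rfl⟩⟩⟩
      · have hgx := h.resolve_left hxc
        obtain ⟨y, hy, hy'⟩ := exists_tendsto_preimage hF hg hlim hx hxc (hφlim' _ hgx)
          (hφ'.mono fun n hn => (hn.mapsTo hgx).1.1)
        exact ⟨y, hy, hy'.mono fun n hn => ⟨hn.1, Or.inr ⟨hgx, hn.2⟩⟩⟩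
    choose y hylim hy using hy
    classical
    refine ⟨fun n x => if hx : x ∈ critSetKMap a b g cg (k + 1) then y ⟨x, hx⟩ n else x,
      ?_, fun x hx => by simpa [hx] using hylim ⟨x, hx⟩⟩
    have := (critSetKMap_finite hg (k + 1)).to_subtype
    have hinj : ∀ᶠ n in atTop, ∀ x x' : critSetKMap a b g cg (k + 1), x ≠ x' → y x n ≠ y x' n :=
      eventually_all.2 fun x => eventually_all.2 fun x' => by
        by_cases h : x = x'
        · simp [h]
        · filter_upwards [((hylim x).sub (hylim x')).eventually_ne
            (sub_ne_zero.2 (Subtype.coe_ne_coe.2 h))] with n hn _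
          exact sub_ne_zero.1 hn
    have hside : ∀ᶠ n in atTop, ∀ x : critSetKMap a b g cg (k + 1),
        (x.1 < cg → y x n < c n) ∧ (cg < x.1 → c n < y x n) :=
      eventually_all.2 fun x => by
        rcases lt_trichotomy x.1 cg with h | h | h
        · filter_upwards [(hylim x).eventually_lt hc h] with n hn
          exact ⟨fun _ => hn, fun h' => absurd h' h.not_gt⟩
        · simp [h]
        · filter_upwards [hc.eventually_lt (hylim x) h] with n hn
          exact ⟨fun h' => absurd h' h.not_gt, fun _ => hn⟩
    have hbig : ∀ᶠ n in atTop, ∀ d ∈ critSetKMap a b g cg k, g cg < d →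
        f n (c n) < φ (n + 1) d :=
      (critSetKMap_finite hg k).eventually_all.2 fun d hd => by
        by_cases h : g cg < d
        · filter_upwards [hfc.eventually_lt (hφlim' d hd) h] with n hn _
          exact hn
        · simp [h]
    filter_upwards [hφ', eventually_all.2 hy, hinj, hside, hbig] with n hφn hyn hinjn hsn hbn
    obtain ⟨-, hm, -, -, -, hmono, hanti⟩ := hF.2 n
    refine ⟨fun x hx => ?_, fun x hx x' hx' hxx' => ?_, fun z hz => ?_⟩
    · simp only [hx, dite_true]
      rw [mem_critSetK_succ hm]
      obtain ⟨h1, h2⟩ := hyn ⟨x, hx⟩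
      refine ⟨h1, h2.imp And.right fun h => ?_⟩
      rw [h.2]
      exact hφn.mapsTo h.1
    · simp only [hx, hx', dite_true] at hxx'
      by_contra hne
      exact hinjn ⟨x, hx⟩ ⟨x', hx'⟩ (by simpa using hne) hxx'
    · suffices ∃ x : critSetKMap a b g cg (k + 1), y x n = z by
        obtain ⟨⟨x, hx⟩, h⟩ := this
        exact ⟨x, hx, by simpa [hx] using h⟩
      obtain ⟨hzI, hz⟩ := (mem_critSetK_succ hm).1 hz
      have happly : ∀ x : critSetKMap a b g cg (k + 1), x.1 ≠ cg →
          f n (y x n) = φ (n + 1) (g x) := fun x hx =>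
        ((hyn x).2.resolve_left fun h => hx h.1).2
      by_cases hzc : z = c n
      · have hcmem : cg ∈ critSetKMap a b g cg (k + 1) :=
          (mem_critSetKMap_succ hg.2.1).2 ⟨hcg, Or.inl rfl⟩
        exact ⟨⟨cg, hcmem⟩, ((hyn ⟨cg, hcmem⟩).2.resolve_right fun h => hgc h.1).2.trans hzc.symm⟩
      obtain ⟨d, hd, hdz⟩ := hφn.surjOn (hz.resolve_left hzc)
      have hdlt : d < g cg := by
        refine lt_of_le_of_ne (le_of_not_gt fun h => ?_) fun h => hgc (h ▸ hd)
        exact (hbn d hd h).not_ge (hdz.trans_le (hF.le_apply_turningPoint n hzI))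
      obtain ⟨⟨x, hx, hxc, rfl⟩, ⟨x', hx', hxc', hgx'⟩⟩ := hg.exists_eq_of_lt hd.1.1 hdlt
      rcases lt_or_gt_of_ne hzc with hlt | hgt
      · let p : critSetKMap a b g cg (k + 1) :=
          ⟨x, (mem_critSetKMap_succ hg.2.1).2 ⟨hx, Or.inr hd⟩⟩
        exact ⟨p, hmono.injOn ⟨(hyn p).1.1, ((hsn p).1 hxc).le⟩ ⟨hzI.1, hlt.le⟩
          ((happly p hxc.ne).trans hdz)⟩
      · let p : critSetKMap a b g cg (k + 1) :=
          ⟨x', (mem_critSetKMap_succ hg.2.1).2 ⟨hx', Or.inr (hgx' ▸ hd)⟩⟩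
        exact ⟨p, hanti.injOn ⟨((hsn p).2 hxc').le, (hyn p).1.2⟩ ⟨hgt.le, hzI.2⟩
          ((happly p hxc'.ne').trans ((congrArg (φ (n + 1)) hgx').trans hdz))⟩

/-- Strictly increasing bijections out of a finite set are unique. -/
lemma StrictMonoOn.eqOn_of_bijOn_of_finite {α β : Type*} [LinearOrder α] [LinearOrder β]
    {s : Set α} {t : Set β} {φ ψ : α → β} (hs : s.Finite) (hφ : StrictMonoOn φ s)
    (hψ : StrictMonoOn ψ s) (hφt : BijOn φ s t) (hψt : BijOn ψ s t) : EqOn φ ψ s := by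
  obtain rfl := hφt.image_eq
  have := hs.to_subtype
  have := (hs.image φ).to_subtype
  intro x hx
  have h := Subsingleton.elim (hφ.orderIso φ s)
    ((hψ.orderIso ψ s).trans (OrderIso.setCongr _ _ hψt.image_eq))
  exact congrArg Subtype.val (DFunLike.congr_fun h ⟨x, hx⟩)

/-- For a UNDS satisfying the limit property with uniform limit map `f₀`: for every
`k ≥ 1` and `ε > 0` there is `N` such that for all `n ≥ N` the finite sets `𝒞_n^k(ℱ)`
and `𝒞^k(f₀)` have the same cardinality, and the (unique) order-preserving bijection
`φ : 𝒞^k(f₀) → 𝒞_n^k(ℱ)` moves every point by less than `ε`. -/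
theorem critSetK_approximates_limit_critSet
    (a b : ℝ) (f : ℕ → ℝ → ℝ) (c : ℕ → ℝ)
    (hF : IsUNDS a b f c)
    (f₀ : ℝ → ℝ) (cf₀ : ℝ)
    (hf₀ : IsUnimodal a b f₀ cf₀)
    (hper : ∀ m : ℕ, 1 ≤ m → f₀^[m] cf₀ ≠ cf₀)
    (hconv : TendstoUniformlyOn (fun n => f n) f₀ Filter.atTop (Icc a b))
    (hdense : ∀ n : ℕ, Icc a b ⊆ closure (critSet a b f c n))
    (hdense₀ : Icc a b ⊆ closure (critSetMap a b f₀ cf₀)) :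
    ∀ k : ℕ, 1 ≤ k → ∀ ε > (0:ℝ), ∃ N : ℕ, ∀ n : ℕ, N ≤ n →
      (critSetK a b f c n k).Finite ∧
      (critSetKMap a b f₀ cf₀ k).Finite ∧
      (critSetK a b f c n k).ncard = (critSetKMap a b f₀ cf₀ k).ncard ∧
      ∀ φ : ℝ → ℝ, StrictMonoOn φ (critSetKMap a b f₀ cf₀ k) →
        BijOn φ (critSetKMap a b f₀ cf₀ k) (critSetK a b f c n k) →
        ∀ x ∈ critSetKMap a b f₀ cf₀ k, |φ x - x| < ε := by
  intro k _ ε hε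
  obtain ⟨φ, hφ, hlim⟩ := exists_bijOn_critSetK_tendsto hF hf₀ hper hconv k
  have hfin := critSetKMap_finite hf₀ k
  have hclose : ∀ᶠ n in atTop, ∀ x ∈ critSetKMap a b f₀ cf₀ k, |φ n x - x| < ε :=
    hfin.eventually_all.2 fun x hx => Metric.tendsto_nhds.1 (hlim x hx) ε hε
  have hmono : ∀ᶠ n in atTop, StrictMonoOn (φ n) (critSetKMap a b f₀ cf₀ k) :=
    hfin.eventually_all.2 fun x hx => hfin.eventually_all.2 fun y hy => by
      by_cases h : x < y
      · filter_upwards [(hlim x hx).eventually_lt (hlim y hy) h] with n hn _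
        exact hn
      · simp [h]
  obtain ⟨N, hN⟩ := eventually_atTop.1 (hφ.and (hclose.and hmono))
  refine ⟨N, fun n hn => ?_⟩
  obtain ⟨hbij, hcl, hmo⟩ := hN n hn
  refine ⟨hbij.image_eq ▸ hfin.image _, hfin, ?_, fun ψ hψ hψb x hx => ?_⟩
  · rw [← hbij.image_eq, hbij.injOn.ncard_image]
  · rw [hψ.eqOn_of_bijOn_of_finite hfin hmo hψb hbij hx]
    exact hcl x hx
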